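/- arXiv:2605.00795 — 4 statements merged into one kernel-verified Lean document; each statement's English description precedes it below -/
import Mathlib

section
/- Let n ≥ 2 be an integer, γ > n real, α = (γ-1)/(n-1), a > 0, and let φ_a(y) = (y_1 y_n^{aα-1}, …, y_{n-1} y_n^{aα-1}, y_n^a). Then for every y ∈ Ω_n the operator norm of the derivative satisfies ‖Dφ_a(y)‖ ≤ y_n^{a-1} · ((aα-1)²(n-1) + (n-1) + a²)^{1/2}. -/
noncomputable section

/-- The simplex `Ω_n = {y : 0 < y_n < 1, 0 < y_i < y_n}`. -/
def simplexDomain (n : ℕ) (hn : 2 ≤ n) : Set (EuclideanSpace ℝ (Fin n)) :=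
  {y | 0 < y ⟨n - 1, by omega⟩ ∧ y ⟨n - 1, by omega⟩ < 1 ∧
    ∀ i : Fin n, (i : ℕ) < n - 1 → 0 < y i ∧ y i < y ⟨n - 1, by omega⟩}

/-- The cusp-straightening map `φ_a(y) = (y_1 y_n^{aα-1}, …, y_{n-1} y_n^{aα-1}, y_n^a)`. -/
def phiMap (n : ℕ) (hn : 2 ≤ n) (a α : ℝ) (y : EuclideanSpace ℝ (Fin n)) :
    EuclideanSpace ℝ (Fin n) :=
  WithLp.toLp 2 fun i : Fin n =>
    if (i : ℕ) < n - 1 then y i * y ⟨n - 1, by omega⟩ ^ (a * α - 1)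
    else y ⟨n - 1, by omega⟩ ^ a

/-- Operator norm bound for the derivative of `φ_a` on `Ω_n`:
`‖Dφ_a(y)‖ ≤ y_n^{a-1} ((aα-1)²(n-1) + (n-1) + a²)^{1/2}` with `α = (γ-1)/(n-1)`. -/
theorem phi_derivative_norm_bound
    (n : ℕ) (hn : 2 ≤ n) (γ a : ℝ) (hγ : (n : ℝ) < γ) (ha : 0 < a)
    (y : EuclideanSpace ℝ (Fin n)) (hy : y ∈ simplexDomain n hn) :
    ‖fderiv ℝ (phiMap n hn a ((γ - 1) / ((n : ℝ) - 1))) y‖ ≤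
      y ⟨n - 1, by omega⟩ ^ (a - 1) *
        Real.sqrt ((a * ((γ - 1) / ((n : ℝ) - 1)) - 1) ^ 2 * ((n : ℝ) - 1) +
          ((n : ℝ) - 1) + a ^ 2) := by
  obtain ⟨m, rfl⟩ : ∃ m, n = m + 1 := ⟨n - 1, by omega⟩
  have hl : (⟨m + 1 - 1, by omega⟩ : Fin (m + 1)) = Fin.last m := rfl
  obtain ⟨h0, h1, h2⟩ := hy
  simp only [hl] at h0 h1 h2 ⊢
  have hm : (1 : ℝ) ≤ m := by exact_mod_cast (by omega : 1 ≤ m)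
  push_cast at hγ ⊢
  rw [add_sub_cancel_right]
  have hα : 1 < (γ - 1) / (m : ℝ) := by
    rw [lt_div_iff₀ (by linarith)]; linarith
  generalize (γ - 1) / (m : ℝ) = α at hα ⊢
  set b := a * α - 1 with hb
  set t := y (Fin.last m) with ht
  have hab : a - 1 ≤ b := by rw [hb]; nlinarith
  have hT : 0 < t ^ (a - 1) := Real.rpow_pos_of_pos h0 _
  have hTb : t ^ b ≤ t ^ (a - 1) := Real.rpow_le_rpow_of_exponent_ge h0 h1.le hab
  have hB : 0 < t ^ b := Real.rpow_pos_of_pos h0 _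
  have hB1 : t ^ b = t * t ^ (b - 1) := by
    rw [Real.rpow_sub_one h0.ne' b, mul_div_cancel₀ _ h0.ne']
  have hBp : 0 < t ^ (b - 1) := Real.rpow_pos_of_pos h0 _
  -- derivatives of the coordinates
  have hp : ∀ i : Fin (m + 1), HasFDerivAt (fun z : EuclideanSpace ℝ (Fin (m + 1)) => z i)
      (EuclideanSpace.proj i : EuclideanSpace ℝ (Fin (m + 1)) →L[ℝ] ℝ) y := fun i =>
    (EuclideanSpace.proj i : EuclideanSpace ℝ (Fin (m + 1)) →L[ℝ] ℝ).hasFDerivAt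
  have hc1 : ∀ i : Fin m, HasFDerivAt (fun z => (phiMap (m + 1) hn a α z) i.castSucc)
      (y i.castSucc • ((b * t ^ (b - 1)) •
          (EuclideanSpace.proj (Fin.last m) : EuclideanSpace ℝ (Fin (m + 1)) →L[ℝ] ℝ)) +
        t ^ b • (EuclideanSpace.proj i.castSucc : EuclideanSpace ℝ (Fin (m + 1)) →L[ℝ] ℝ)) y := by
    intro i
    have e : (fun z => (phiMap (m + 1) hn a α z) i.castSucc)
        = fun z => z i.castSucc * (z (Fin.last m)) ^ b := by
      funext z
      simp [phiMap, hb]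
      exact Or.inl rfl
    rw [e]
    exact (hp i.castSucc).mul ((hp (Fin.last m)).rpow_const (Or.inl h0.ne'))
  have hc2 : HasFDerivAt (fun z => (phiMap (m + 1) hn a α z) (Fin.last m))
      ((a * t ^ (a - 1)) •
          (EuclideanSpace.proj (Fin.last m) : EuclideanSpace ℝ (Fin (m + 1)) →L[ℝ] ℝ)) y := by
    have e : (fun z => (phiMap (m + 1) hn a α z) (Fin.last m))
        = fun z => (z (Fin.last m)) ^ a := by
      funext z
      simp [phiMap]
      rfl
    rw [e]
    exact (hp (Fin.last m)).rpow_const (Or.inl h0.ne')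
  have hd : DifferentiableAt ℝ (phiMap (m + 1) hn a α) y := by
    rw [differentiableAt_euclidean]
    intro i
    refine Fin.lastCases ?_ (fun i => ?_) i
    · exact hc2.differentiableAt
    · exact (hc1 i).differentiableAt
  have hq : ∀ i : Fin (m + 1), HasFDerivAt (fun z => (phiMap (m + 1) hn a α z) i)
      ((EuclideanSpace.proj i : EuclideanSpace ℝ (Fin (m + 1)) →L[ℝ] ℝ).comp
        (fderiv ℝ (phiMap (m + 1) hn a α) y)) y := fun i =>
    (EuclideanSpace.proj i : EuclideanSpace ℝ (Fin (m + 1)) →L[ℝ] ℝ).hasFDerivAt.comp y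
      hd.hasFDerivAt
  refine ContinuousLinearMap.opNorm_le_bound _ (by positivity) fun v => ?_
  have e1 : ∀ i : Fin m, (fderiv ℝ (phiMap (m + 1) hn a α) y v) i.castSucc
      = y i.castSucc * (b * t ^ (b - 1) * v (Fin.last m)) + t ^ b * v i.castSucc := by
    intro i
    have := congrArg (fun L => L v) ((hq i.castSucc).unique (hc1 i))
    simpa using this
  have e2 : (fderiv ℝ (phiMap (m + 1) hn a α) y v) (Fin.last m)
      = a * t ^ (a - 1) * v (Fin.last m) := by
    have := congrArg (fun L => L v) ((hq (Fin.last m)).unique hc2)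
    simpa using this
  have hv : ‖v‖ ^ 2 = ∑ i : Fin m, v i.castSucc ^ 2 + v (Fin.last m) ^ 2 := by
    rw [EuclideanSpace.real_norm_sq_eq, Fin.sum_univ_castSucc]
  have hvi : ∀ i : Fin m, v i.castSucc ^ 2 + v (Fin.last m) ^ 2 ≤ ‖v‖ ^ 2 := by
    intro i
    rw [hv]
    have := Finset.single_le_sum (f := fun i : Fin m => v i.castSucc ^ 2)
      (fun j _ => sq_nonneg _) (Finset.mem_univ i)
    simp only at this
    linarith
  have hvl : v (Fin.last m) ^ 2 ≤ ‖v‖ ^ 2 := by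
    rw [hv]
    have := Finset.sum_nonneg (s := Finset.univ) (f := fun i : Fin m => v i.castSucc ^ 2)
      (fun j _ => sq_nonneg _)
    linarith
  have k1 : ∀ i : Fin m, (fderiv ℝ (phiMap (m + 1) hn a α) y v) i.castSucc ^ 2
      ≤ (t ^ (a - 1)) ^ 2 * ((1 + b ^ 2) * ‖v‖ ^ 2) := by
    intro i
    rw [e1]
    obtain ⟨p0, p1⟩ := h2 i.castSucc (by simp)
    set c := y i.castSucc * t ^ (b - 1) with hc
    have c0 : 0 < c := mul_pos p0 hBp
    have c1 : c ≤ t ^ (a - 1) := by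
      refine le_trans ?_ hTb
      rw [hB1, hc]
      exact mul_le_mul_of_nonneg_right p1.le hBp.le
    clear_value c
    have r : y i.castSucc * (b * t ^ (b - 1) * v (Fin.last m)) + t ^ b * v i.castSucc
        = c * (b * v (Fin.last m)) + t ^ b * v i.castSucc := by rw [hc]; ring
    rw [r]
    have s1 : |c * (b * v (Fin.last m)) + t ^ b * v i.castSucc|
        ≤ t ^ (a - 1) * (|b| * |v (Fin.last m)| + |v i.castSucc|) := by
      refine (abs_add_le _ _).trans ?_
      rw [abs_mul, abs_mul, abs_mul, abs_of_pos c0, abs_of_pos hB, mul_add]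
      gcongr
    rw [← sq_abs]
    refine (pow_le_pow_left₀ (abs_nonneg _) s1 2).trans ?_
    rw [mul_pow]
    refine mul_le_mul_of_nonneg_left ?_ (sq_nonneg _)
    have s2 : (|b| * |v (Fin.last m)| + |v i.castSucc|) ^ 2
        ≤ (1 + b ^ 2) * (v i.castSucc ^ 2 + v (Fin.last m) ^ 2) := by
      rw [← sq_abs b, ← sq_abs (v i.castSucc), ← sq_abs (v (Fin.last m))]
      nlinarith [sq_nonneg (|b| * |v i.castSucc| - |v (Fin.last m)|)]
    exact s2.trans (mul_le_mul_of_nonneg_left (hvi i) (by positivity))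
  have k2 : (fderiv ℝ (phiMap (m + 1) hn a α) y v) (Fin.last m) ^ 2
      ≤ (t ^ (a - 1)) ^ 2 * (a ^ 2 * ‖v‖ ^ 2) := by
    rw [e2]
    have : (a * t ^ (a - 1) * v (Fin.last m)) ^ 2
      = (t ^ (a - 1)) ^ 2 * (a ^ 2 * v (Fin.last m) ^ 2) := by ring
    rw [this]
    gcongr
  refine abs_le_of_sq_le_sq' ?_ (by positivity) |>.2
  rw [EuclideanSpace.real_norm_sq_eq, Fin.sum_univ_castSucc, mul_pow, mul_pow,
    Real.sq_sqrt (by positivity)]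
  have k3 := Finset.sum_le_sum (s := Finset.univ) fun i _ => k1 i
  rw [Finset.sum_const, Finset.card_univ, Fintype.card_fin, nsmul_eq_mul] at k3
  refine (add_le_add k3 k2).trans (le_of_eq ?_)
  ring
end
end

section
/- Let n ≥ 2 be an integer, γ > n real, 1 < p < n, α = (γ-1)/(n-1), and let 0 < a ≤ (n-p)/(γ-p). Let φ_a(y) = (y_1 y_n^{aα-1}, …, y_{n-1} y_n^{aα-1}, y_n^a). Then for every y ∈ Ω_n one has the distortion bound ‖Dφ_a(y)‖^p / |det Dφ_a(y)| ≤ (1/a) · ((n-1)((aα-1)² + 1) + a²)^{p/2}. In particular, the distortion quotient K_{p,p}(φ_a; Ω_n) = ess sup_{Ω_n} (‖Dφ_a(y)‖^p / |det Dφ_a(y)|)^{1/p} is finite. -/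
open MeasureTheory ENNReal

noncomputable section

/-- The Jacobian matrix of `phiMap`. -/
def jacM (m : ℕ) (a β : ℝ) (y : EuclideanSpace ℝ (Fin (m+1))) :
    Matrix (Fin (m+1)) (Fin (m+1)) ℝ :=
  fun i j => if i = Fin.last m then (if j = Fin.last m then a * y (Fin.last m) ^ (a - 1) else 0)
    else (if i = j then y (Fin.last m) ^ β else 0) +
      (if j = Fin.last m then y i * (β * y (Fin.last m) ^ (β - 1)) else 0)

lemma jacM_det (m : ℕ) (a β : ℝ) (y : EuclideanSpace ℝ (Fin (m+1))) :
    (jacM m a β y).det = (y (Fin.last m) ^ β) ^ m * (a * y (Fin.last m) ^ (a - 1)) := by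
  have h : (jacM m a β y).BlockTriangular id := by
    intro i j hij
    simp only [id] at hij
    have h1 : j ≠ Fin.last m := fun h => by
      subst h; exact absurd (Fin.le_last i) (not_le.2 hij)
    simp [jacM, h1, hij.ne']
  rw [Matrix.det_of_isUpperTriangular h, Fin.prod_univ_castSucc]
  simp [jacM, Fin.castSucc_ne_last]

lemma jacM_mulVec (m : ℕ) (a β : ℝ) (y v : EuclideanSpace ℝ (Fin (m+1))) (i : Fin (m+1)) :
    (Matrix.toEuclideanCLM (𝕜 := ℝ) (jacM m a β y) v) i =
    if i = Fin.last m then a * y (Fin.last m) ^ (a - 1) * v (Fin.last m)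
    else y (Fin.last m) ^ β * v i + y i * (β * y (Fin.last m) ^ (β - 1)) * v (Fin.last m) := by
  rw [Matrix.ofLp_toEuclideanCLM]
  simp only [Matrix.mulVec, dotProduct, jacM]
  split_ifs with h
  · simp [ite_mul]
  · simp [add_mul, Finset.sum_add_distrib, ite_mul]

lemma phi_hasFDerivAt (m : ℕ) (hm : 2 ≤ m + 1) (a α : ℝ) (y : EuclideanSpace ℝ (Fin (m+1)))
    (hy : 0 < y (Fin.last m)) :
    HasFDerivAt (phiMap (m+1) hm a α) (Matrix.toEuclideanCLM (𝕜 := ℝ) (jacM m a (a*α-1) y)) y := by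
  rw [← hasFDerivWithinAt_univ, hasFDerivWithinAt_euclidean]
  intro i
  rw [hasFDerivWithinAt_univ]
  have hc : ∀ j : Fin (m+1), HasFDerivAt (fun z : EuclideanSpace ℝ (Fin (m+1)) => z j)
      (EuclideanSpace.proj j : EuclideanSpace ℝ (Fin (m+1)) →L[ℝ] ℝ) y := fun j =>
    (EuclideanSpace.proj j : EuclideanSpace ℝ (Fin (m+1)) →L[ℝ] ℝ).hasFDerivAt
  have hr : ∀ r : ℝ, HasFDerivAt (fun z : EuclideanSpace ℝ (Fin (m+1)) => z (Fin.last m) ^ r)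
      ((r * y (Fin.last m) ^ (r-1)) •
        (EuclideanSpace.proj (Fin.last m) : EuclideanSpace ℝ (Fin (m+1)) →L[ℝ] ℝ)) y := fun r =>
    (hc (Fin.last m)).rpow_const (Or.inl hy.ne')
  by_cases h : i = Fin.last m
  · have h2 : ¬ ((i : ℕ) < m + 1 - 1) := by subst h; simp
    have := hr a
    refine (this.congr_fderiv ?_).congr_of_eventuallyEq ?_
    · ext v
      have := jacM_mulVec m a (a*α-1) y v i
      rw [if_pos h] at this
      simpa using this.symm
    · refine Filter.Eventually.of_forall fun z => ?_
      simp only [phiMap, if_neg h2]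
      rfl
  · have h2 : (i : ℕ) < m + 1 - 1 := by
      have := Fin.val_lt_last h
      simpa using this
    have := (hc i).mul (hr (a*α-1))
    refine (this.congr_fderiv ?_).congr_of_eventuallyEq ?_
    · ext v
      have := jacM_mulVec m a (a*α-1) y v i
      rw [if_neg h] at this
      refine Eq.trans ?_ this.symm
      simp
      ring
    · refine Filter.Eventually.of_forall fun z => ?_
      simp only [phiMap, if_pos h2]
      rfl

lemma jac_norm_le (m : ℕ) (a β : ℝ) (y : EuclideanSpace ℝ (Fin (m+1)))
    (hy : 0 < y (Fin.last m)) (hy1 : y (Fin.last m) < 1) (hβ : a - 1 ≤ β)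
    (hyi : ∀ i, i ≠ Fin.last m → 0 < y i ∧ y i < y (Fin.last m)) :
    ‖Matrix.toEuclideanCLM (𝕜 := ℝ) (jacM m a β y)‖ ≤
      Real.sqrt ((m : ℝ) * (β^2 + 1) + a^2) * y (Fin.last m) ^ (a - 1) := by
  set t := y (Fin.last m) with ht
  have hs : 0 < t ^ (a-1) := Real.rpow_pos_of_pos hy _
  have hb : 0 < t ^ β := Real.rpow_pos_of_pos hy _
  have hbs : t ^ β ≤ t ^ (a-1) := Real.rpow_le_rpow_of_exponent_ge hy hy1.le hβ
  have hb1 : t ^ (β-1) * t = t ^ β := by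
    rw [← Real.rpow_add_one hy.ne']; congr 1; ring
  have hb1p : 0 < t ^ (β-1) := Real.rpow_pos_of_pos hy _
  refine ContinuousLinearMap.opNorm_le_bound _ (by positivity) fun v => ?_
  have hC : 0 ≤ (m : ℝ) * (β^2 + 1) + a^2 := by positivity
  refine abs_le_of_sq_le_sq' ?_ (by positivity) |>.2
  rw [mul_pow, mul_pow, Real.sq_sqrt hC, EuclideanSpace.real_norm_sq_eq]
  have hv : ∀ i, i ≠ Fin.last m → v i ^ 2 + v (Fin.last m) ^ 2 ≤ ‖v‖^2 := by
    intro i hi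
    rw [EuclideanSpace.real_norm_sq_eq, ← Finset.sum_pair (f := fun j => v j ^ 2) hi]
    exact Finset.sum_le_sum_of_subset_of_nonneg (Finset.subset_univ _) fun _ _ _ => sq_nonneg _
  have hvl : v (Fin.last m) ^ 2 ≤ ‖v‖^2 := by
    rw [EuclideanSpace.real_norm_sq_eq]
    exact Finset.single_le_sum (f := fun i => v i ^ 2) (fun _ _ => sq_nonneg _) (Finset.mem_univ _)
  have hterm : ∀ i, i ≠ Fin.last m →
      (t ^ β * v i + y i * (β * t ^ (β - 1)) * v (Fin.last m))^2 ≤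
        (β^2+1) * (t ^ (a-1))^2 * ‖v‖^2 := by
    intro i hi
    obtain ⟨h0, h1⟩ := hyi i hi
    set q := y i * t ^ (β-1) with hq
    have hq0 : 0 ≤ q := by positivity
    have hq1 : q ≤ t ^ (a-1) := by
      refine le_trans ?_ hbs
      rw [← hb1, hq, mul_comm]
      exact mul_le_mul_of_nonneg_left h1.le hb1p.le
    have hq2 : q^2 ≤ (t ^ (a-1))^2 := by gcongr
    have hb2 : (t^β)^2 ≤ (t ^ (a-1))^2 := by gcongr
    calc (t ^ β * v i + y i * (β * t ^ (β - 1)) * v (Fin.last m))^2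
        = (t^β * v i + β * (q * v (Fin.last m)))^2 := by rw [hq]; ring
      _ ≤ (β^2+1) * ((t^β)^2 * v i^2 + q^2 * v (Fin.last m)^2) := by
          nlinarith [sq_nonneg (β * (t^β * v i) - q * v (Fin.last m))]
      _ ≤ (β^2+1) * ((t ^ (a-1))^2 * v i^2 + (t ^ (a-1))^2 * v (Fin.last m)^2) := by gcongr
      _ = (β^2+1) * (t ^ (a-1))^2 * (v i^2 + v (Fin.last m)^2) := by ring
      _ ≤ _ := by gcongr; exact hv i hi
  rw [Fin.sum_univ_castSucc]
  simp only [jacM_mulVec, Fin.castSucc_ne_last, if_false, if_true, ← ht]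
  calc _ ≤ ∑ i : Fin m, (β^2+1) * (t ^ (a-1))^2 * ‖v‖^2 + a^2 * (t ^ (a-1))^2 * ‖v‖^2 := by
        refine add_le_add (Finset.sum_le_sum fun i _ => hterm _ (Fin.castSucc_ne_last i)) ?_
        rw [mul_pow, mul_pow]
        gcongr
    _ = _ := by simp; ring

lemma pointwise_bound (m : ℕ) (hm : 2 ≤ m + 1) (γ p a : ℝ)
    (hγ : ((m:ℝ)+1) < γ) (hp1 : 1 < p) (hpn : p < (m:ℝ)+1)
    (ha0 : 0 < a) (ha1 : a ≤ ((m : ℝ) + 1 - p) / (γ - p))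
    (y) (hy : y ∈ simplexDomain (m+1) hm) :
      ‖fderiv ℝ (phiMap (m+1) hm a ((γ - 1) / (m : ℝ))) y‖ ^ p /
          |(fderiv ℝ (phiMap (m+1) hm a ((γ - 1) / (m:ℝ))) y).det| ≤
        (1 / a) * ((m:ℝ) * ((a * ((γ - 1) / (m:ℝ)) - 1) ^ 2 + 1) + a ^ 2)
          ^ (p / 2) := by
  obtain ⟨h0, h1, h2⟩ := hy
  change 0 < y (Fin.last m) at h0
  change y (Fin.last m) < 1 at h1
  have h3 : ∀ i, i ≠ Fin.last m → 0 < y i ∧ y i < y (Fin.last m) := fun i hi =>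
    h2 i (by have := Fin.val_lt_last hi; simpa using this)
  have hm0 : (0:ℝ) < m := by
    have : 0 < m := by omega
    exact_mod_cast this
  set β := a * ((γ - 1) / (m : ℝ)) - 1 with hβ
  have hβ1 : a - 1 ≤ β := by
    have : 1 ≤ (γ - 1) / m := by rw [le_div_iff₀ hm0]; linarith
    nlinarith
  have hmβ : β * m = a * (γ - 1) - m := by rw [hβ]; field_simp
  rw [(phi_hasFDerivAt m hm a _ y h0).fderiv, ← hβ]
  have hn := jac_norm_le m a β y h0 h1 hβ1 h3
  have hdet : (Matrix.toEuclideanCLM (𝕜 := ℝ) (jacM m a β y)).det = a * y (Fin.last m) ^ (a * γ - (m+1)) := by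
    have : (Matrix.toEuclideanCLM (𝕜 := ℝ) (jacM m a β y)).det = (jacM m a β y).det := by
      rw [ContinuousLinearMap.det, Matrix.coe_toEuclideanCLM_eq_toEuclideanLin]
      rw [Matrix.toEuclideanLin_eq_toLin, LinearMap.det_toLin]
    rw [this, jacM_det, ← Real.rpow_mul_natCast h0.le, hmβ]
    rw [mul_left_comm, ← Real.rpow_add h0]
    congr 2; ring
  rw [hdet]
  set t := y (Fin.last m) with ht
  set C := (m:ℝ) * (β^2+1) + a^2 with hCdef
  have hC : 0 ≤ C := by positivity
  have htp : 0 < t ^ (a * γ - (m+1)) := Real.rpow_pos_of_pos h0 _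
  rw [abs_of_pos (by positivity), div_le_iff₀ (by positivity)]
  have hexp : a * γ - (m+1) ≤ (a-1) * p := by
    rw [le_div_iff₀ (by linarith)] at ha1
    nlinarith
  calc _ ≤ (Real.sqrt C * t ^ (a-1)) ^ p := by gcongr
    _ = C ^ (p/2) * t ^ ((a-1)*p) := by
        rw [Real.mul_rpow (Real.sqrt_nonneg _) (Real.rpow_nonneg h0.le _), Real.sqrt_eq_rpow,
          ← Real.rpow_mul hC, ← Real.rpow_mul h0.le]
        congr 2; ring
    _ ≤ C ^ (p/2) * t ^ (a * γ - (m+1)) := by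
        gcongr ?_ * ?_
        exact Real.rpow_le_rpow_of_exponent_ge h0 h1.le hexp
    _ = _ := by field_simp

lemma simplexDomain_measurable (n : ℕ) (hn : 2 ≤ n) : MeasurableSet (simplexDomain n hn) := by
  have hc : ∀ i : Fin n, Measurable fun y : EuclideanSpace ℝ (Fin n) => y i := fun i => by
    fun_prop
  have he : simplexDomain n hn = {y | 0 < y ⟨n - 1, by omega⟩} ∩ ({y | y ⟨n - 1, by omega⟩ < 1} ∩
      ⋂ i : Fin n, ⋂ _ : (i : ℕ) < n - 1, ({y | 0 < y i} ∩ {y | y i < y ⟨n - 1, by omega⟩})) := by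
    ext y
    simp [simplexDomain]
  rw [he]
  refine (measurableSet_lt measurable_const (hc _)).inter
    ((measurableSet_lt (hc _) measurable_const).inter ?_)
  refine MeasurableSet.iInter fun i => MeasurableSet.iInter fun _ => ?_
  exact (measurableSet_lt measurable_const (hc _)).inter (measurableSet_lt (hc _) (hc _))

/-- Pointwise distortion bound for `φ_a` on `Ω_n` when `0 < a ≤ (n-p)/(γ-p)`, and finiteness
of the distortion quotient `K_{p,p}(φ_a; Ω_n)`. -/
theorem phi_distortion_bound
    (n : ℕ) (hn : 2 ≤ n) (γ p a : ℝ)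
    (hγ : (n : ℝ) < γ) (hp1 : 1 < p) (hpn : p < n)
    (ha0 : 0 < a) (ha1 : a ≤ ((n : ℝ) - p) / (γ - p)) :
    (∀ y ∈ simplexDomain n hn,
      ‖fderiv ℝ (phiMap n hn a ((γ - 1) / ((n : ℝ) - 1))) y‖ ^ p /
          |(fderiv ℝ (phiMap n hn a ((γ - 1) / ((n : ℝ) - 1))) y).det| ≤
        (1 / a) * (((n : ℝ) - 1) * ((a * ((γ - 1) / ((n : ℝ) - 1)) - 1) ^ 2 + 1) + a ^ 2)
          ^ (p / 2)) ∧
    essSup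
      (fun y => ENNReal.ofReal
        ((‖fderiv ℝ (phiMap n hn a ((γ - 1) / ((n : ℝ) - 1))) y‖ ^ p /
          |(fderiv ℝ (phiMap n hn a ((γ - 1) / ((n : ℝ) - 1))) y).det|) ^ (1 / p)))
      (volume.restrict (simplexDomain n hn)) < ⊤ := by
  have h : ∀ y ∈ simplexDomain n hn,
      ‖fderiv ℝ (phiMap n hn a ((γ - 1) / ((n : ℝ) - 1))) y‖ ^ p /
          |(fderiv ℝ (phiMap n hn a ((γ - 1) / ((n : ℝ) - 1))) y).det| ≤
        (1 / a) * (((n : ℝ) - 1) * ((a * ((γ - 1) / ((n : ℝ) - 1)) - 1) ^ 2 + 1) + a ^ 2)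
          ^ (p / 2) := by
    obtain ⟨m, rfl⟩ : ∃ m, n = m + 1 := ⟨n - 1, by omega⟩
    push_cast at hγ hpn ha1 ⊢
    simp only [add_sub_cancel_right]
    exact fun y hy => pointwise_bound m hn γ p a hγ hp1 hpn ha0 ha1 y hy
  refine ⟨h, ?_⟩
  refine lt_of_le_of_lt (essSup_le_of_ae_le (ENNReal.ofReal
    (((1 / a) * (((n : ℝ) - 1) * ((a * ((γ - 1) / ((n : ℝ) - 1)) - 1) ^ 2 + 1) + a ^ 2)
          ^ (p / 2)) ^ (1 / p))) ?_) ENNReal.ofReal_lt_top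
  filter_upwards [ae_restrict_mem (simplexDomain_measurable n hn)] with y hy
  refine ENNReal.ofReal_le_ofReal (Real.rpow_le_rpow (by positivity) (h y hy) ?_)
  exact one_div_nonneg.2 (by linarith)
end
end

section
/- Let n ≥ 3 be an integer, γ > n real, α = (γ-1)/(n-1), a > 0, and fix i ∈ {1,…,n-1}. Let Φ_i^0 : ℝ^{n-1} → ℝ^n be the parametrization Φ_i^0(x̂, t) whose i-th coordinate is 0, whose n-th coordinate is t, and whose remaining coordinates are the entries of x̂ = (x_1,…,x_{i-1},x_{i+1},…,x_{n-1}), and let G = ψ_a ∘ Φ_i^0 where ψ_a(x) = (x_1 x_n^{(1-aα)/a}, …, x_{n-1} x_n^{(1-aα)/a}, x_n^{1/a}). Then for every (x̂, t) with t > 0, G is differentiable at (x̂, t) and its tangential Jacobian satisfies √(det( DG(x̂,t)ᵀ · DG(x̂,t) )) = (1/a) · t^{(n-1)/a - (n-2)α - 1}. -/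
noncomputable section

/-- The inverse cusp-straightening map
`ψ_a(x) = (x_1 x_n^{(1-aα)/a}, …, x_{n-1} x_n^{(1-aα)/a}, x_n^{1/a})`. -/
def psiMap (n : ℕ) (hn : 2 ≤ n) (a α : ℝ) (x : EuclideanSpace ℝ (Fin n)) :
    EuclideanSpace ℝ (Fin n) :=
  WithLp.toLp 2 fun i : Fin n =>
    if (i : ℕ) < n - 1 then x i * x ⟨n - 1, by omega⟩ ^ ((1 - a * α) / a)
    else x ⟨n - 1, by omega⟩ ^ (1 / a)

/-- Parametrization `Φ_i^0(x̂, t)` of the flat boundary face `{x_i = 0}`: the `i`-th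
coordinate is `0`, the `n`-th coordinate is `t = u_{n-2}`, and the remaining coordinates
are the entries of `x̂ = (u_0, …, u_{n-3})` (0-based indexing). -/
def flatFaceParam (n : ℕ) (hn : 3 ≤ n) (i : ℕ) (hi : i < n - 1)
    (u : EuclideanSpace ℝ (Fin (n - 1))) : EuclideanSpace ℝ (Fin n) :=
  WithLp.toLp 2 fun k : Fin n =>
    if hk : (k : ℕ) < n - 1 then
      if (k : ℕ) = i then 0
      else if (k : ℕ) < i then u ⟨(k : ℕ), by omega⟩
      else u ⟨(k : ℕ) - 1, by omega⟩
    else u ⟨n - 2, by omega⟩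

/-- The component functions, after the vanishing coordinate is removed, are differentiable. -/
theorem ffComp_hasFDerivAt (m : ℕ) (l k : Fin m) (p q : ℝ)
    (u : EuclideanSpace ℝ (Fin m)) (ht : 0 < u l) :
    HasFDerivAt (fun v : EuclideanSpace ℝ (Fin m) =>
        if k ≠ l then v k * v l ^ p else v l ^ q)
      (if k ≠ l then
        u k • ((p * u l ^ (p - 1)) • (EuclideanSpace.proj l : EuclideanSpace ℝ (Fin m) →L[ℝ] ℝ))
          + (u l ^ p) • (EuclideanSpace.proj k : EuclideanSpace ℝ (Fin m) →L[ℝ] ℝ)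
       else (q * u l ^ (q - 1)) • (EuclideanSpace.proj l : EuclideanSpace ℝ (Fin m) →L[ℝ] ℝ)) u := by
  have hp : ∀ j : Fin m, HasFDerivAt (fun v : EuclideanSpace ℝ (Fin m) => v j)
      (EuclideanSpace.proj j : EuclideanSpace ℝ (Fin m) →L[ℝ] ℝ) u := fun j =>
    (EuclideanSpace.proj j : EuclideanSpace ℝ (Fin m) →L[ℝ] ℝ).hasFDerivAt
  split_ifs with h
  · exact (hp k).mul ((hp l).rpow_const (Or.inl (ne_of_gt ht)))
  · exact (hp l).rpow_const (Or.inl (ne_of_gt ht))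

/-- The composition in coordinates. -/
theorem ffComp_eq (m : ℕ) (hm : 2 ≤ m) (a α : ℝ) (i : ℕ) (hi : i < m)
    (v : EuclideanSpace ℝ (Fin m)) (k : Fin m) :
    psiMap (m + 1) (by omega) a α (flatFaceParam (m + 1) (by omega) i hi v)
        ((⟨i, by omega⟩ : Fin (m + 1)).succAbove k) =
      if k ≠ ⟨m - 1, by omega⟩ then v k * v ⟨m - 1, by omega⟩ ^ ((1 - a * α) / a)
      else v ⟨m - 1, by omega⟩ ^ (1 / a) := by
  obtain ⟨k, hk⟩ := k
  have e : (((⟨i, by omega⟩ : Fin (m + 1)).succAbove ⟨k, hk⟩ : Fin (m + 1)) : ℕ)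
      = if k < i then k else k + 1 := by
    by_cases h : k < i <;> simp [Fin.succAbove, Fin.lt_def, h]
  generalize (⟨i, by omega⟩ : Fin (m + 1)).succAbove ⟨k, hk⟩ = r at e
  obtain ⟨r, hr⟩ := r
  simp only at e
  by_cases h : k < i
  · rw [if_pos h] at e
    subst e
    have h1 : r < m := hk
    have h2 : r ≠ m - 1 := by omega
    have h3 : r ≠ i := by omega
    simp [psiMap, flatFaceParam, h1, h2, h3, h]
  · rw [if_neg h] at e
    subst e
    by_cases h1 : k = m - 1
    · have : ¬ (k + 1 < m) := by omega
      simp [psiMap, flatFaceParam, h1]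
      intro h5
      omega
    · have h2 : k + 1 < m := by omega
      have h3 : k + 1 ≠ i := by omega
      have h4 : ¬ (k + 1 < i) := by omega
      simp [psiMap, flatFaceParam, h1, h2, h3, h4]

theorem ffComp_zero (m : ℕ) (hm : 2 ≤ m) (a α : ℝ) (i : ℕ) (hi : i < m)
    (v : EuclideanSpace ℝ (Fin m)) :
    psiMap (m + 1) (by omega) a α (flatFaceParam (m + 1) (by omega) i hi v)
        (⟨i, by omega⟩ : Fin (m + 1)) = 0 := by
  simp [psiMap, flatFaceParam, hi]

/-- Determinant of the triangular matrix. -/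
theorem ff_det (m : ℕ) (hm : 2 ≤ m) (A : Matrix (Fin m) (Fin m) ℝ) (c d : ℝ)
    (w : Fin m → ℝ)
    (hA : ∀ k j, A k j = if k ≠ ⟨m - 1, by omega⟩ then
        w k * (if j = ⟨m - 1, by omega⟩ then 1 else 0) + c * (if j = k then 1 else 0)
      else d * (if j = ⟨m - 1, by omega⟩ then 1 else 0)) :
    A.det = c ^ (m - 1) * d := by
  obtain ⟨m, rfl⟩ : ∃ r, m = r + 1 := ⟨m - 1, by omega⟩
  have hl : (⟨m + 1 - 1, by omega⟩ : Fin (m + 1)) = Fin.last m := rfl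
  simp only [hl] at hA
  rw [Matrix.det_of_isUpperTriangular, Fin.prod_univ_castSucc]
  · simp [hA, (Fin.castSucc_lt_last _).ne]
  · intro k j hjk
    have hjk : j < k := hjk
    have h1 : j ≠ Fin.last m := (lt_of_lt_of_le hjk (Fin.le_last k)).ne
    simp [hA, h1, hjk.ne]

/-- On the flat boundary face `F_i^0`, `G = ψ_a ∘ Φ_i^0` is differentiable and its tangential
Jacobian equals `(1/a) t^{(n-1)/a - (n-2)α - 1}`, where `α = (γ-1)/(n-1)`, `t > 0`. -/
theorem flat_face_tangential_jacobian
    (n : ℕ) (hn : 3 ≤ n) (γ a : ℝ) (hγ : (n : ℝ) < γ) (ha : 0 < a)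
    (i : ℕ) (hi : i < n - 1)
    (u : EuclideanSpace ℝ (Fin (n - 1))) (ht : 0 < u ⟨n - 2, by omega⟩) :
    DifferentiableAt ℝ
      (fun v => psiMap n (by omega) a ((γ - 1) / ((n : ℝ) - 1)) (flatFaceParam n hn i hi v))
      u ∧
    (let G : EuclideanSpace ℝ (Fin (n - 1)) → EuclideanSpace ℝ (Fin n) :=
      fun v => psiMap n (by omega) a ((γ - 1) / ((n : ℝ) - 1)) (flatFaceParam n hn i hi v);
    let M : Matrix (Fin n) (Fin (n - 1)) ℝ :=
      LinearMap.toMatrix ((EuclideanSpace.basisFun (Fin (n - 1)) ℝ).toBasis)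
        ((EuclideanSpace.basisFun (Fin n) ℝ).toBasis) (fderiv ℝ G u).toLinearMap;
    Real.sqrt (M.transpose * M).det =
      (1 / a) * u ⟨n - 2, by omega⟩ ^
        (((n : ℝ) - 1) / a - ((n : ℝ) - 2) * ((γ - 1) / ((n : ℝ) - 1)) - 1)) := by
  obtain ⟨m, rfl⟩ : ∃ m, n = m + 1 := ⟨n - 1, by omega⟩
  have hm : 2 ≤ m := by omega
  have hi' : i < m := hi
  set α : ℝ := (γ - 1) / (((m + 1 : ℕ) : ℝ) - 1) with hα
  change EuclideanSpace ℝ (Fin m) at u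
  set l : Fin m := ⟨m - 1, by omega⟩ with hl
  have ht' : 0 < u l := ht
  set I : Fin (m + 1) := ⟨i, by omega⟩ with hI
  set p : ℝ := (1 - a * α) / a with hp
  have key : ∀ G : EuclideanSpace ℝ (Fin m) → EuclideanSpace ℝ (Fin (m + 1)),
      (∀ v, G v = psiMap (m + 1) (by omega) a α (flatFaceParam (m + 1) hn i hi v)) →
      DifferentiableAt ℝ G u ∧
      ∀ M : Matrix (Fin (m + 1)) (Fin m) ℝ,
        M = LinearMap.toMatrix ((EuclideanSpace.basisFun (Fin m) ℝ).toBasis)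
        ((EuclideanSpace.basisFun (Fin (m + 1)) ℝ).toBasis) (fderiv ℝ G u).toLinearMap →
      Real.sqrt (M.transpose * M).det =
      (1 / a) * u l ^
        ((((m + 1 : ℕ) : ℝ) - 1) / a - (((m + 1 : ℕ) : ℝ) - 2) * α - 1) := by
    intro G hG
    have h0 : ∀ v, G v I = 0 := fun v => by
      rw [hG]; exact ffComp_zero m hm a α i hi' v
    have h1 : ∀ k : Fin m, (fun v => G v (I.succAbove k)) =
        fun v => if k ≠ l then v k * v l ^ p else v l ^ (1 / a) := fun k => by
      funext v
      rw [hG]; exact ffComp_eq m hm a α i hi' v k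
    have hd : ∀ k : Fin m, HasFDerivAt (fun v => G v (I.succAbove k)) _ u := fun k => by
      rw [h1]; exact ffComp_hasFDerivAt m l k p (1 / a) u ht'
    have hd0 : HasFDerivAt (fun v => G v I) (0 : EuclideanSpace ℝ (Fin m) →L[ℝ] ℝ) u := by
      simp only [h0]; exact hasFDerivAt_const _ _
    have hdiff : DifferentiableAt ℝ G u := by
      rw [differentiableAt_euclidean]
      intro r
      rcases Fin.eq_self_or_eq_succAbove I r with h | ⟨k, h⟩
      · rw [h]; exact hd0.differentiableAt
      · rw [h]; exact (hd k).differentiableAt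
    refine ⟨hdiff, ?_⟩
    rintro M hM
    have hG' : ∀ r, HasFDerivAt (fun v => G v r)
        ((EuclideanSpace.proj r : EuclideanSpace ℝ (Fin (m + 1)) →L[ℝ] ℝ).comp
          (fderiv ℝ G u)) u := fun r =>
      (EuclideanSpace.proj r : EuclideanSpace ℝ (Fin (m + 1)) →L[ℝ] ℝ).hasFDerivAt.comp u
        hdiff.hasFDerivAt
    have hMe : ∀ r j, M r j = fderiv ℝ G u (EuclideanSpace.single j 1) r := by
      intro r j
      rw [hM, LinearMap.toMatrix_apply]
      simp
    have hM0 : ∀ j, M I j = 0 := fun j => by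
      rw [hMe]
      have := congrArg (fun L => L (EuclideanSpace.single j (1 : ℝ))) ((hG' I).unique hd0)
      simpa using this
    have hM1 : ∀ k j, M (I.succAbove k) j = if k ≠ l then
        (u k * (p * u l ^ (p - 1))) * (if j = l then 1 else 0)
          + u l ^ p * (if j = k then 1 else 0)
      else (1 / a * u l ^ (1 / a - 1)) * (if j = l then 1 else 0) := fun k j => by
      rw [hMe]
      have := congrArg (fun L => L (EuclideanSpace.single j (1 : ℝ)))
        ((hG' (I.succAbove k)).unique (hd k))
      refine Eq.trans (Eq.trans ?_ this) ?_
      · simp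
      · have hs : ∀ r : Fin m, (EuclideanSpace.proj r : EuclideanSpace ℝ (Fin m) →L[ℝ] ℝ)
            (EuclideanSpace.single j (1 : ℝ)) = if j = r then 1 else 0 := fun r => by
          by_cases h : j = r
          · subst h; simp
          · simp [h]
        clear this
        by_cases h : k ≠ l
        · simp only [if_pos h, add_apply, smul_apply, hs,
            smul_eq_mul, mul_assoc]
        · simp only [if_neg h, smul_apply, hs, smul_eq_mul]
    set A : Matrix (Fin m) (Fin m) ℝ := M.submatrix I.succAbove id with hAdef
    have hMA : M.transpose * M = A.transpose * A := by
      ext j j'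
      simp only [Matrix.mul_apply, Matrix.transpose_apply]
      rw [Fin.sum_univ_succAbove _ I]
      simp [hM0, hAdef]
    have hA := ff_det m hm A (u l ^ p) (1 / a * u l ^ (1 / a - 1))
      (fun k => u k * (p * u l ^ (p - 1))) (fun k j => hM1 k j)
    rw [hMA, Matrix.det_mul, Matrix.det_transpose, Real.sqrt_mul_self, hA]
    · rw [← Real.rpow_natCast, ← Real.rpow_mul ht'.le, mul_left_comm, ← Real.rpow_add ht']
      congr 2
      rw [Nat.cast_sub (by omega), hp]
      push_cast
      field_simp
      ring
    · rw [hA]; positivity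
  exact ⟨(key _ fun v => rfl).1, (key _ fun v => rfl).2 _ rfl⟩
end
end

section
/- Let n ≥ 2 be an integer, γ > n real, 1 < p < n, α = (γ-1)/(n-1), and a = (n-p)/(γ-p). Let φ_a(y) = (y_1 y_n^{aα-1}, …, y_{n-1} y_n^{aα-1}, y_n^a) and ψ_a(x) = (x_1 x_n^{(1-aα)/a}, …, x_{n-1} x_n^{(1-aα)/a}, x_n^{1/a}). Then for every y ∈ Ω_n and every x ∈ Ω_γ: (‖Dφ_a(y)‖^p / |det Dφ_a(y)|)^{1/p} ≤ a^{-1/p} · ( (n-1) + (n-p)²/(γ-p)² + (p-1)²(γ-n)²/((γ-p)²(n-1)) )^{1/2} and |det Dψ_a(x)|^{1/p} ≤ a^{-1/p}. -/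
noncomputable section

/-- The outward `γ`-cuspidal domain `Ω_γ`. -/
def cuspDomain (n : ℕ) (hn : 2 ≤ n) (γ : ℝ) : Set (EuclideanSpace ℝ (Fin n)) :=
  {x | 0 < x ⟨n - 1, by omega⟩ ∧ x ⟨n - 1, by omega⟩ < 1 ∧
    ∀ i : Fin n, (i : ℕ) < n - 1 →
      0 < x i ∧ x i < x ⟨n - 1, by omega⟩ ^ ((γ - 1) / ((n : ℝ) - 1))}

/-- common form of the maps -/
def genMap (m : ℕ) (b e : ℝ) (y : EuclideanSpace ℝ (Fin (m+1))) :
    EuclideanSpace ℝ (Fin (m+1)) :=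
  WithLp.toLp 2 fun i : Fin (m+1) =>
    if (i : ℕ) < m then y i * y (Fin.last m) ^ b else y (Fin.last m) ^ e

lemma genMap_hasFDerivAt (m : ℕ) (b e : ℝ) (y : EuclideanSpace ℝ (Fin (m+1)))
    (hy : 0 < y (Fin.last m)) (v : EuclideanSpace ℝ (Fin (m+1))) (i : Fin (m+1)) :
    fderiv ℝ (genMap m b e) y v i =
      if (i : ℕ) < m then v i * y (Fin.last m) ^ b +
        y i * (b * y (Fin.last m) ^ (b-1)) * v (Fin.last m)
      else e * y (Fin.last m) ^ (e-1) * v (Fin.last m) := by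
  have hpr : ∀ j : Fin (m+1), HasFDerivAt (fun z : EuclideanSpace ℝ (Fin (m+1)) => z j)
      (EuclideanSpace.proj j : EuclideanSpace ℝ (Fin (m+1)) →L[ℝ] ℝ) y := fun j =>
    (EuclideanSpace.proj j : EuclideanSpace ℝ (Fin (m+1)) →L[ℝ] ℝ).hasFDerivAt
  have hpow : ∀ c : ℝ, HasFDerivAt (fun z : EuclideanSpace ℝ (Fin (m+1)) => z (Fin.last m) ^ c)
      ((c * y (Fin.last m) ^ (c-1)) •
        (EuclideanSpace.proj (Fin.last m) : EuclideanSpace ℝ (Fin (m+1)) →L[ℝ] ℝ)) y := fun c =>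
    (hpr (Fin.last m)).rpow_const (Or.inl hy.ne')
  have hcomp : ∀ j : Fin (m+1), DifferentiableAt ℝ
      (fun z : EuclideanSpace ℝ (Fin (m+1)) => genMap m b e z j) y := by
    intro j
    by_cases h : (j : ℕ) < m
    · simp only [genMap, h, if_true]
      exact ((hpr j).mul (hpow b)).differentiableAt
    · simp only [genMap, h, if_false]
      exact (hpow e).differentiableAt
  have hd : DifferentiableAt ℝ (genMap m b e) y := differentiableAt_euclidean.2 hcomp
  have h1 : HasFDerivAt (fun z => genMap m b e z i)
      ((EuclideanSpace.proj i : EuclideanSpace ℝ (Fin (m+1)) →L[ℝ] ℝ).comp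
        (fderiv ℝ (genMap m b e) y)) y :=
    (EuclideanSpace.proj i : EuclideanSpace ℝ (Fin (m+1)) →L[ℝ] ℝ).hasFDerivAt.comp y
      hd.hasFDerivAt
  by_cases h : (i : ℕ) < m
  · simp only [genMap, h, if_true] at h1 ⊢
    have := congrArg (fun f => f v) (h1.unique ((hpr i).mul (hpow b)))
    simp at this
    change fderiv ℝ (genMap m b e) y v i = _ at this
    rw [this]; ring
  · simp only [genMap, h, if_false] at h1 ⊢
    have := congrArg (fun f => f v) (h1.unique (hpow e))
    simpa using this

lemma genMap_det (m : ℕ) (b e : ℝ) (y : EuclideanSpace ℝ (Fin (m+1)))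
    (hy : 0 < y (Fin.last m)) :
    (fderiv ℝ (genMap m b e) y).det =
      (y (Fin.last m) ^ b) ^ m * (e * y (Fin.last m) ^ (e-1)) := by
  rw [ContinuousLinearMap.det, ← LinearMap.det_toMatrix (EuclideanSpace.basisFun (Fin (m+1)) ℝ).toBasis]
  have hM : ∀ i j, LinearMap.toMatrix (EuclideanSpace.basisFun (Fin (m+1)) ℝ).toBasis
      (EuclideanSpace.basisFun (Fin (m+1)) ℝ).toBasis
      (fderiv ℝ (genMap m b e) y : EuclideanSpace ℝ (Fin (m+1)) →ₗ[ℝ] EuclideanSpace ℝ (Fin (m+1))) i j =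
      fderiv ℝ (genMap m b e) y (EuclideanSpace.single j 1) i := by
    intro i j
    simp [LinearMap.toMatrix_apply]
  rw [Matrix.det_of_isUpperTriangular]
  · simp only [hM, genMap_hasFDerivAt m b e y hy]
    rw [Fin.prod_univ_castSucc]
    simp [(Fin.castSucc_ne_last _).symm]
  · intro i j hij
    rw [hM, genMap_hasFDerivAt m b e y hy]
    have hij' : j < i := hij
    have h1 : i ≠ j := hij'.ne'
    have h2 : Fin.last m ≠ j := (lt_of_lt_of_le hij' (Fin.le_last i)).ne'
    simp [h1, h2]

lemma genMap_norm (m : ℕ) (b e : ℝ) (y : EuclideanSpace ℝ (Fin (m+1)))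
    (hy : 0 < y (Fin.last m)) (hy1 : y (Fin.last m) < 1)
    (hyi : ∀ i : Fin (m+1), (i : ℕ) < m → 0 < y i ∧ y i < y (Fin.last m)) (hb : e - 1 ≤ b) :
    ‖fderiv ℝ (genMap m b e) y‖ ≤
      y (Fin.last m) ^ (e-1) * √(m + e ^ 2 + m * b ^ 2) := by
  set t := y (Fin.last m) with ht
  apply ContinuousLinearMap.opNorm_le_bound _ (by positivity)
  intro v
  refine (pow_le_pow_iff_left₀ (norm_nonneg _) (by positivity) two_ne_zero).1 ?_
  rw [mul_pow, mul_pow, Real.sq_sqrt (by positivity), EuclideanSpace.real_norm_sq_eq,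
    Fin.sum_univ_castSucc]
  have hT : t ^ b ≤ t ^ (e-1) := Real.rpow_le_rpow_of_exponent_ge hy hy1.le hb
  have hTb : 0 < t ^ b := Real.rpow_pos_of_pos hy _
  have hvv : ∀ i : Fin m, v i.castSucc ^ 2 + v (Fin.last m) ^ 2 ≤ ‖v‖ ^ 2 := by
    intro i
    rw [EuclideanSpace.real_norm_sq_eq, Fin.sum_univ_castSucc]
    gcongr
    exact Finset.single_le_sum (f := fun i : Fin m => v i.castSucc ^ 2)
      (fun _ _ => sq_nonneg _) (Finset.mem_univ i)
  have hvl : v (Fin.last m) ^ 2 ≤ ‖v‖ ^ 2 := by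
    rw [EuclideanSpace.real_norm_sq_eq, Fin.sum_univ_castSucc]
    have := Finset.sum_nonneg (s := Finset.univ) (f := fun i : Fin m => v i.castSucc ^ 2)
      (fun _ _ => sq_nonneg _)
    linarith
  have key : ∀ i : Fin m, fderiv ℝ (genMap m b e) y v i.castSucc ^ 2 ≤
      (t ^ (e-1)) ^ 2 * (1 + b ^ 2) * ‖v‖ ^ 2 := by
    intro i
    rw [genMap_hasFDerivAt m b e y hy]
    simp only [Fin.val_castSucc, Fin.is_lt, if_true, ← ht]
    obtain ⟨h0, h1⟩ := hyi i.castSucc (by simp)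
    have hs : t ^ (b-1) = t ^ b / t := by rw [Real.rpow_sub_one hy.ne']
    set r := y i.castSucc / t with hr
    have hr0 : 0 ≤ r := by positivity
    have hr1 : r ≤ 1 := (div_le_one hy).2 h1.le
    have e1 : v i.castSucc * t ^ b + y i.castSucc * (b * t ^ (b-1)) * v (Fin.last m) =
        t ^ b * (v i.castSucc + r * b * v (Fin.last m)) := by
      rw [hs, hr]; field_simp
    rw [e1, mul_pow]
    have h2 : (v i.castSucc + r * b * v (Fin.last m)) ^ 2 ≤ (1 + b^2) * ‖v‖^2 := by
      calc _ ≤ (1 + (r*b)^2) * (v i.castSucc ^ 2 + v (Fin.last m) ^ 2) := by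
            nlinarith [sq_nonneg (r * b * v i.castSucc - v (Fin.last m))]
        _ ≤ (1 + b^2) * ‖v‖^2 := by
            have : (r*b)^2 ≤ b^2 := by
              rw [mul_pow]; nlinarith [sq_nonneg b, pow_le_one₀ hr0 hr1 (n := 2)]
            gcongr
            exact hvv i
    have h3 : (t ^ b) ^ 2 ≤ (t ^ (e-1)) ^ 2 := by gcongr
    have h4 := mul_le_mul h3 h2 (sq_nonneg _) (sq_nonneg _)
    linarith
  have key2 : fderiv ℝ (genMap m b e) y v (Fin.last m) ^ 2 ≤ (t ^ (e-1)) ^ 2 * e ^ 2 * ‖v‖ ^ 2 := by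
    rw [genMap_hasFDerivAt m b e y hy]
    simp only [Fin.val_last, lt_irrefl, if_false, ← ht]
    calc _ = (t ^ (e-1)) ^ 2 * e ^ 2 * v (Fin.last m) ^ 2 := by ring
      _ ≤ _ := by gcongr
  have := Finset.sum_le_sum (s := Finset.univ) (fun i (_ : i ∈ Finset.univ) => key i)
  simp only [Finset.sum_const, Finset.card_univ, Fintype.card_fin, nsmul_eq_mul] at this
  nlinarith [this, key2]

/-- Explicit distortion bounds for the optimal parameter `a = (n-p)/(γ-p)`:
`(‖Dφ_a(y)‖^p/|det Dφ_a(y)|)^{1/p} ≤ a^{-1/p}((n-1) + (n-p)²/(γ-p)² +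
(p-1)²(γ-n)²/((γ-p)²(n-1)))^{1/2}` on `Ω_n`, and `|det Dψ_a(x)|^{1/p} ≤ a^{-1/p}` on `Ω_γ`. -/
theorem optimal_parameter_distortion_bounds
    (n : ℕ) (hn : 2 ≤ n) (γ p : ℝ)
    (hγ : (n : ℝ) < γ) (hp1 : 1 < p) (hpn : p < n) :
    let α : ℝ := (γ - 1) / ((n : ℝ) - 1);
    let a : ℝ := ((n : ℝ) - p) / (γ - p);
    (∀ y ∈ simplexDomain n hn,
      (‖fderiv ℝ (phiMap n hn a α) y‖ ^ p / |(fderiv ℝ (phiMap n hn a α) y).det|) ^ (1 / p) ≤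
        a ^ (-(1 / p)) *
          Real.sqrt (((n : ℝ) - 1) + ((n : ℝ) - p) ^ 2 / (γ - p) ^ 2 +
            (p - 1) ^ 2 * (γ - n) ^ 2 / ((γ - p) ^ 2 * ((n : ℝ) - 1)))) ∧
    (∀ x ∈ cuspDomain n hn γ,
      |(fderiv ℝ (psiMap n hn a α) x).det| ^ (1 / p) ≤ a ^ (-(1 / p))) := by
  obtain ⟨m, rfl⟩ : ∃ m, n = m + 1 := ⟨n - 1, by omega⟩
  intro α a
  have hm : (0:ℝ) < m := by
    have : 0 < m := by omega
    exact_mod_cast this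
  push_cast at hγ hpn
  have hα : α = (γ - 1) / m := by simp [α]
  have ha : a = (m + 1 - p) / (γ - p) := by simp [a]
  have hgp : 0 < γ - p := by linarith
  have hmp : 0 < (m:ℝ) + 1 - p := by linarith
  have ha0 : 0 < a := by rw [ha]; positivity
  have hp0 : 0 < p := by linarith
  have hα1 : 1 ≤ α := by rw [hα, le_div_iff₀ hm]; linarith
  have hagp : a * (γ - p) = m + 1 - p := by rw [ha]; field_simp
  have hαm : α * m = γ - 1 := by rw [hα]; field_simp
  constructor
  · rintro y ⟨h0, h1, h2⟩
    change 0 < y (Fin.last m) at h0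
    change y (Fin.last m) < 1 at h1
    change ∀ i : Fin (m+1), (i:ℕ) < m → 0 < y i ∧ y i < y (Fin.last m) at h2
    change (‖fderiv ℝ (genMap m (a * α - 1) a) y‖ ^ p /
      |(fderiv ℝ (genMap m (a * α - 1) a) y).det|) ^ (1 / p) ≤ _
    have hN := genMap_norm m (a * α - 1) a y h0 h1 h2 (by nlinarith)
    rw [genMap_det m _ _ y h0]
    have hS : (((m + 1 : ℕ) : ℝ) - 1) + (((m + 1 : ℕ) : ℝ) - p) ^ 2 / (γ - p) ^ 2 +
            (p - 1) ^ 2 * (γ - (m + 1 : ℕ)) ^ 2 / ((γ - p) ^ 2 * (((m + 1 : ℕ) : ℝ) - 1)) =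
        m + a ^ 2 + m * (a * α - 1) ^ 2 := by
      push_cast
      rw [ha, hα, add_sub_cancel_right]
      field_simp
      ring
    rw [hS]
    set S := √((m:ℝ) + a ^ 2 + m * (a * α - 1) ^ 2) with hSdef
    set t := y (Fin.last m) with ht
    have hS0 : 0 ≤ S := Real.sqrt_nonneg _
    have hdet : (t ^ (a * α - 1)) ^ m * (a * t ^ (a - 1)) = a * (t ^ (a - 1)) ^ p := by
      rw [← Real.rpow_natCast, ← Real.rpow_mul h0.le, ← Real.rpow_mul h0.le, mul_left_comm,
        ← Real.rpow_add h0]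
      congr 2
      linear_combination a * hαm + hagp
    have hTp : 0 < (t ^ (a - 1)) ^ p := by positivity
    rw [hdet, abs_of_pos (by positivity)]
    have hq : ‖fderiv ℝ (genMap m (a * α - 1) a) y‖ ^ p / (a * (t ^ (a - 1)) ^ p) ≤ a⁻¹ * S ^ p := by
      rw [div_le_iff₀ (by positivity)]
      calc _ ≤ (t ^ (a - 1) * S) ^ p := by gcongr
        _ = _ := by
          rw [Real.mul_rpow (by positivity) hS0]
          field_simp
    calc _ ≤ (a⁻¹ * S ^ p) ^ (1 / p) := by gcongr
      _ = _ := by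
        rw [Real.mul_rpow (by positivity) (by positivity), ← Real.rpow_mul hS0,
          mul_one_div_cancel hp0.ne', Real.rpow_one, Real.inv_rpow ha0.le, Real.rpow_neg ha0.le]
  · rintro x ⟨h0, h1, -⟩
    change 0 < x (Fin.last m) at h0
    change x (Fin.last m) < 1 at h1
    change |(fderiv ℝ (genMap m ((1 - a * α) / a) (1 / a)) x).det| ^ (1 / p) ≤ _
    rw [genMap_det m _ _ x h0]
    set t := x (Fin.last m) with ht
    rw [Real.rpow_neg ha0.le, ← Real.inv_rpow ha0.le, abs_of_pos (by positivity)]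
    apply Real.rpow_le_rpow (by positivity) _ (by positivity)
    rw [← Real.rpow_natCast, ← Real.rpow_mul h0.le, mul_left_comm, ← Real.rpow_add h0, one_div]
    apply mul_le_of_le_one_right (by positivity)
    apply Real.rpow_le_one h0.le h1.le
    have : (1 - a * α) / a * m + (a⁻¹ - 1) = p * (γ - (m + 1)) / (m + 1 - p) := by
      rw [ha, hα]
      field_simp
      ring
    rw [this]
    have : 0 < γ - (m + 1) := by linarith
    positivity
end
end
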